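/- arXiv:2601.19388 — 2 statements merged into one kernel-verified Lean document; each statement's English description precedes it below -/
import Mathlib

section
/- In the independent-set reduction with m ≥ 1 edges, suppose there exists a schedule M', obtained from the constructed input schedule M by applying to each agent a sequence of collapses, such that M' is feasible and cost(M') ≤ cost(M) − 4m − 2K. Then H has an independent set of size at least K; indeed, the set S of vertices u ∈ U whose vertex-agent trajectory in M' is the constant trajectory at x_u is an independent set of H with |S| ≥ K. -/
/-- The cost of a trajectory `π : ℕ → V` of horizon `T`: the number of timesteps
`t < T` with `π t ≠ π (t+1)`. -/
noncomputable def cost {V : Type*} (π : ℕ → V) (T : ℕ) : ℕ :=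
  {t | t < T ∧ π t ≠ π (t + 1)}.ncard

/-- The collapse of the trajectory `π` on the interval `[a, b]`:
all positions in `[a, b]` are rewritten to `π a`, other positions are unchanged. -/
def collapse {V : Type*} (π : ℕ → V) (a b : ℕ) : ℕ → V :=
  fun t => if a ≤ t ∧ t ≤ b then π a else π t

/-- One collapse step on trajectories of horizon `T`: `π'` is obtained from `π` by
collapsing a closed subwalk `[a, b]` with `a < b ≤ T` and `π a = π b`. -/
def CollapseStep {V : Type*} (T : ℕ) (π π' : ℕ → V) : Prop :=
  ∃ a b, a < b ∧ b ≤ T ∧ π a = π b ∧ π' = collapse π a b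

/-- A schedule `M : ι → ℕ → V` is `G`-valid up to horizon `T` if every consecutive
pair of positions of every agent is equal (waiting) or joined by an edge of `G`. -/
def GValid {V ι : Type*} (G : SimpleGraph V) (T : ℕ) (M : ι → ℕ → V) : Prop :=
  ∀ i, ∀ t < T, M i t = M i (t + 1) ∨ G.Adj (M i t) (M i (t + 1))

/-- No two distinct agents occupy the same vertex at the same timestep `t ≤ T`. -/
def NoVertexCollision {V ι : Type*} (T : ℕ) (M : ι → ℕ → V) : Prop :=
  ∀ i j, i ≠ j → ∀ t ≤ T, M i t ≠ M j t

/-- No two distinct agents traverse the same edge in opposite directions: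
there are no `i ≠ j` and `t < T` with `M i t = M j (t+1)`, `M i (t+1) = M j t` and
`M j t ≠ M i t`. -/
def NoEdgeCollision {V ι : Type*} (T : ℕ) (M : ι → ℕ → V) : Prop :=
  ∀ i j, i ≠ j → ∀ t < T,
    ¬(M i t = M j (t + 1) ∧ M i (t + 1) = M j t ∧ M j t ≠ M i t)

/-- A schedule is feasible if it is `G`-valid and has no vertex and no edge collisions. -/
def Feasible {V ι : Type*} (G : SimpleGraph V) (T : ℕ) (M : ι → ℕ → V) : Prop :=
  GValid G T M ∧ NoVertexCollision T M ∧ NoEdgeCollision T M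

/-- The cost of a schedule: the sum of the costs of the agents' trajectories. -/
noncomputable def scheduleCost {V ι : Type*} [Fintype ι] (M : ι → ℕ → V) (T : ℕ) : ℕ :=
  ∑ i, cost (M i) T

/-! ### The independent-set reduction

Given a finite simple graph `H = (U, F)` with `m ≥ 1` edges enumerated by `Fin m`,
where edge `r` has endpoints `eu r` and `ev r`, we construct the MAPF instance of the
reduction: the vertex set `RV U m` (vertices `xv u`, `pv u` for `u : U` and
`av r`, `bv r`, `cv r` for `r : Fin m`, all pairwise distinct), the simple graph
`RG m eu ev`, the horizon `7*m - 1`, the vertex-agent trajectories `Atraj`,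
the edge-agent trajectories `Btraj` (with block start `Θ_r = 7*r`), and the input
schedule `Msched` for the agents `U ⊕ Fin m`. -/

/-- Vertex set of the constructed MAPF instance. -/
abbrev RV (U : Type*) (m : ℕ) := (U ⊕ U) ⊕ (Fin m × Fin 3)

/-- The vertex `x_u`. -/
def xv {U : Type*} {m : ℕ} (u : U) : RV U m := Sum.inl (Sum.inl u)

/-- The vertex `p_u`. -/
def pv {U : Type*} {m : ℕ} (u : U) : RV U m := Sum.inl (Sum.inr u)

/-- The vertex `a_{e_r}`. -/
def av {U : Type*} {m : ℕ} (r : Fin m) : RV U m := Sum.inr (r, 0)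

/-- The vertex `b_{e_r}`. -/
def bv {U : Type*} {m : ℕ} (r : Fin m) : RV U m := Sum.inr (r, 1)

/-- The vertex `c_{e_r}`. -/
def cv {U : Type*} {m : ℕ} (r : Fin m) : RV U m := Sum.inr (r, 2)

/-- The simple graph `G` of the constructed MAPF instance: edges `{x_u, p_u}` for each
`u`, and `{a_e, x_u}, {x_u, b_e}, {b_e, c_e}, {c_e, a_e}, {a_e, x_v}, {x_v, b_e}` for
each edge `e = (u, v)` of `H`. -/
def RG {U : Type*} (m : ℕ) (eu ev : Fin m → U) : SimpleGraph (RV U m) :=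
  SimpleGraph.fromRel (fun w z =>
    (∃ u, w = xv u ∧ z = pv u) ∨
    (∃ r, (w = av r ∧ z = xv (eu r)) ∨ (w = xv (eu r) ∧ z = bv r) ∨
          (w = bv r ∧ z = cv r) ∨ (w = cv r ∧ z = av r) ∨
          (w = av r ∧ z = xv (ev r)) ∨ (w = xv (ev r) ∧ z = bv r)))

/-- The vertex-agent trajectory `A_u`: at `x_u` at times `0` and `T = 7*m - 1`, at
`p_u` at all times strictly in between. -/
def Atraj {U : Type*} (m : ℕ) (u : U) : ℕ → RV U m :=
  fun t => if t = 0 then xv u else if t < 7 * m - 1 then pv u else xv u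

/-- The edge-agent trajectory `B_{e_r}` with block start `Θ_r = 7*r`: it waits at
`a_{e_r}` until `Θ_r`, follows `(a_{e_r}, x_{u_r}, b_{e_r}, c_{e_r}, a_{e_r}, x_{v_r},
b_{e_r})` on `[Θ_r, Θ_r + 6]`, and waits at `b_{e_r}` afterwards. -/
def Btraj {U : Type*} {m : ℕ} (eu ev : Fin m → U) (r : Fin m) : ℕ → RV U m :=
  fun t =>
    if t ≤ 7 * (r : ℕ) then av r
    else if t = 7 * (r : ℕ) + 1 then xv (eu r)
    else if t = 7 * (r : ℕ) + 2 then bv r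
    else if t = 7 * (r : ℕ) + 3 then cv r
    else if t = 7 * (r : ℕ) + 4 then av r
    else if t = 7 * (r : ℕ) + 5 then xv (ev r)
    else bv r

/-- The constructed input schedule `M` for the agents `U ⊕ Fin m`. -/
def Msched {U : Type*} (m : ℕ) (eu ev : Fin m → U) : (U ⊕ Fin m) → ℕ → RV U m :=
  Sum.elim (Atraj m) (Btraj eu ev)

/-- The edge-agent trajectory with its detour through `b`, `c`, `a` cut at `a`: it only visits
the second endpoint. -/
def BtrajLate {U : Type*} {m : ℕ} (ev : Fin m → U) (r : Fin m) : ℕ → RV U m :=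
  fun t => if t ≤ 7 * (r : ℕ) + 4 then av r
    else if t = 7 * (r : ℕ) + 5 then xv (ev r) else bv r

/-- The edge-agent trajectory with its detour through `c`, `a`, `b` cut at `b`: it only visits
the first endpoint. -/
def BtrajEarly {U : Type*} {m : ℕ} (eu : Fin m → U) (r : Fin m) : ℕ → RV U m :=
  fun t => if t ≤ 7 * (r : ℕ) then av r
    else if t = 7 * (r : ℕ) + 1 then xv (eu r) else bv r

theorem CollapseStep.eq_Atraj_or_const {U : Type*} {m : ℕ} {u : U} {π π' : ℕ → RV U m}
    (hπ : π = Atraj m u ∨ π = fun _ => xv u) (h : CollapseStep (7 * m - 1) π π') :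
    π' = Atraj m u ∨ π' = fun _ => xv u := by
  have hxp : (xv u : RV U m) ≠ pv u := by simp [xv, pv]
  obtain ⟨a, b, hab, hb, hπab, rfl⟩ := h
  rcases hπ with rfl | rfl
  · by_cases ha : a = 0
    · right
      funext t
      simp only [Atraj, collapse] at *
      grind (splits := 20)
    · left
      funext t
      simp only [Atraj, collapse] at *
      grind (splits := 20)
  · right
    funext t
    simp [collapse]

theorem CollapseStep.eq_Btraj_or_late_or_early {U : Type*} {m : ℕ} {eu ev : Fin m → U}
    {r : Fin m} (huv : eu r ≠ ev r) {T : ℕ} {π π' : ℕ → RV U m}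
    (hπ : π = Btraj eu ev r ∨ π = BtrajLate ev r ∨ π = BtrajEarly eu r)
    (h : CollapseStep T π π') :
    π' = Btraj eu ev r ∨ π' = BtrajLate ev r ∨ π' = BtrajEarly eu r := by
  have hxx : (xv (eu r) : RV U m) ≠ xv (ev r) := by simpa [xv] using huv
  have hax (u : U) : (av r : RV U m) ≠ xv u := by simp [av, xv]
  have hbx (u : U) : (bv r : RV U m) ≠ xv u := by simp [bv, xv]
  have hcx (u : U) : (cv r : RV U m) ≠ xv u := by simp [cv, xv]
  have hab : (av r : RV U m) ≠ bv r := by simp [av, bv]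
  have hac : (av r : RV U m) ≠ cv r := by simp [av, cv]
  have hbc : (bv r : RV U m) ≠ cv r := by simp [bv, cv]
  have hau := hax (eu r)
  have hav := hax (ev r)
  have hbu := hbx (eu r)
  have hbv := hbx (ev r)
  have hcu := hcx (eu r)
  have hcv := hcx (ev r)
  clear hax hbx hcx
  obtain ⟨a, b, hlt, -, hπab, rfl⟩ := h
  rcases hπ with rfl | rfl | rfl
  · by_cases hlate : a ≤ 7 * (r : ℕ) ∧ b = 7 * (r : ℕ) + 4
    · right; left
      funext t
      simp only [Btraj, BtrajLate, collapse] at *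
      grind (splits := 20)
    by_cases hearly : a = 7 * (r : ℕ) + 2 ∧ 7 * (r : ℕ) + 6 ≤ b
    · right; right
      funext t
      simp only [Btraj, BtrajEarly, collapse] at *
      grind (splits := 20)
    left
    have hconst : b ≤ 7 * (r : ℕ) ∨ 7 * (r : ℕ) + 6 ≤ a := by
      simp only [Btraj] at hπab
      grind (splits := 20)
    funext t
    simp only [Btraj, collapse]
    grind (splits := 20)
  · right; left
    have hconst : b ≤ 7 * (r : ℕ) + 4 ∨ 7 * (r : ℕ) + 6 ≤ a := by
      simp only [BtrajLate] at hπab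
      grind (splits := 20)
    funext t
    simp only [BtrajLate, collapse]
    grind (splits := 20)
  · right; right
    have hconst : b ≤ 7 * (r : ℕ) ∨ 7 * (r : ℕ) + 2 ≤ a := by
      simp only [BtrajEarly] at hπab
      grind (splits := 20)
    funext t
    simp only [BtrajEarly, collapse]
    grind (splits := 20)

theorem eq_Atraj_or_const_of_reachable {U : Type*} {m : ℕ} {u : U} {π : ℕ → RV U m}
    (h : Relation.ReflTransGen (CollapseStep (7 * m - 1)) (Atraj m u) π) :
    π = Atraj m u ∨ π = fun _ => xv u := by
  induction h with
  | refl => exact Or.inl rfl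
  | tail _ hstep ih => exact hstep.eq_Atraj_or_const ih

theorem eq_Btraj_or_late_or_early_of_reachable {U : Type*} {m : ℕ} {eu ev : Fin m → U}
    {r : Fin m} (huv : eu r ≠ ev r) {T : ℕ} {π : ℕ → RV U m}
    (h : Relation.ReflTransGen (CollapseStep T) (Btraj eu ev r) π) :
    π = Btraj eu ev r ∨ π = BtrajLate ev r ∨ π = BtrajEarly eu r := by
  induction h with
  | refl => exact Or.inl rfl
  | tail _ hstep ih => exact hstep.eq_Btraj_or_late_or_early huv ih

theorem cost_le_card {V : Type*} {π : ℕ → V} {T : ℕ} (s : Finset ℕ)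
    (hs : ∀ t < T, π t ≠ π (t + 1) → t ∈ s) : cost π T ≤ s.card := by
  rw [cost, ← Set.ncard_coe_finset]
  exact Set.ncard_le_ncard (fun t ht => hs t ht.1 ht.2) s.finite_toSet

theorem card_le_cost {V : Type*} {π : ℕ → V} {T : ℕ} (s : Finset ℕ)
    (hs : ∀ t ∈ s, t < T ∧ π t ≠ π (t + 1)) : s.card ≤ cost π T := by
  rw [cost, ← Set.ncard_coe_finset]
  exact Set.ncard_le_ncard hs ((Set.finite_Iio T).subset fun t ht => ht.1)

theorem cost_Atraj_le {U : Type*} (m : ℕ) (u : U) : cost (Atraj m u) (7 * m - 1) ≤ 2 := by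
  refine (cost_le_card {0, 7 * m - 2} fun t ht hne => ?_).trans Finset.card_le_two
  simp only [Atraj, Finset.mem_insert, Finset.mem_singleton] at *
  grind (splits := 20)

theorem cost_Btraj_le {U : Type*} {m : ℕ} (eu ev : Fin m → U) (r : Fin m) (T : ℕ) :
    cost (Btraj eu ev r) T ≤ 6 := by
  refine (cost_le_card (Finset.Ico (7 * (r : ℕ)) (7 * r + 6)) fun t _ hne => ?_).trans (by simp)
  simp only [Btraj, Finset.mem_Ico] at *
  grind (splits := 20)

theorem two_le_cost_BtrajLate {U : Type*} {m : ℕ} (ev : Fin m → U) (r : Fin m) :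
    2 ≤ cost (BtrajLate ev r) (7 * m - 1) := by
  have hr := r.isLt
  refine le_trans (by simp) (card_le_cost (Finset.Ico (7 * (r : ℕ) + 4) (7 * r + 6)) fun t ht => ?_)
  rw [Finset.mem_Ico] at ht
  refine ⟨by omega, ?_⟩
  obtain rfl | rfl : t = 7 * (r : ℕ) + 4 ∨ t = 7 * (r : ℕ) + 5 := by omega
  all_goals simp [BtrajLate, av, bv, xv]

theorem two_le_cost_BtrajEarly {U : Type*} {m : ℕ} (eu : Fin m → U) (r : Fin m) :
    2 ≤ cost (BtrajEarly eu r) (7 * m - 1) := by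
  have hr := r.isLt
  refine le_trans (by simp) (card_le_cost (Finset.Ico (7 * (r : ℕ)) (7 * r + 2)) fun t ht => ?_)
  rw [Finset.mem_Ico] at ht
  refine ⟨by omega, ?_⟩
  obtain rfl | rfl : t = 7 * (r : ℕ) ∨ t = 7 * (r : ℕ) + 1 := by omega
  all_goals simp [BtrajEarly, av, bv, xv]

/-- conversely, if some schedule `M'` obtained from the constructed input
schedule by per-agent sequences of collapses is feasible with
`cost(M') ≤ cost(M) − 4m − 2K`, then the set `S` of vertices `u` whose vertex-agent
trajectory in `M'` is the constant trajectory at `x_u` is an independent set of `H`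
with `|S| ≥ K`. -/
theorem stmt_14 {U : Type*} [Fintype U] (m : ℕ) (hm : 1 ≤ m) (eu ev : Fin m → U)
    (huv : ∀ r, eu r ≠ ev r)
    (hinj : ∀ r s : Fin m,
      ((eu r = eu s ∧ ev r = ev s) ∨ (eu r = ev s ∧ ev r = eu s)) → r = s)
    (K : ℕ) (M' : (U ⊕ Fin m) → ℕ → RV U m)
    (hreach : ∀ i, Relation.ReflTransGen (CollapseStep (7 * m - 1))
        (Msched m eu ev i) (M' i))
    (hfeas : Feasible (RG m eu ev) (7 * m - 1) M')
    (hcost : scheduleCost M' (7 * m - 1) + (4 * m + 2 * K)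
        ≤ scheduleCost (Msched m eu ev) (7 * m - 1)) :
    (∀ r : Fin m,
      ¬(eu r ∈ {u : U | ∀ t ≤ 7 * m - 1, M' (Sum.inl u) t = xv u} ∧
        ev r ∈ {u : U | ∀ t ≤ 7 * m - 1, M' (Sum.inl u) t = xv u})) ∧
    K ≤ {u : U | ∀ t ≤ 7 * m - 1, M' (Sum.inl u) t = xv u}.ncard := by
  classical
  have hA u := eq_Atraj_or_const_of_reachable (hreach (Sum.inl u))
  have hB r := eq_Btraj_or_late_or_early_of_reachable (huv r) (hreach (Sum.inr r))
  obtain ⟨-, hvert, -⟩ := hfeas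
  refine ⟨?_, ?_⟩
  · rintro r ⟨hu, hv⟩
    have hr := r.isLt
    have hvisit : M' (Sum.inr r) (7 * r + 1) = xv (eu r) ∨
        M' (Sum.inr r) (7 * r + 5) = xv (ev r) := by
      rcases hB r with h | h | h <;> simp [h, Btraj, BtrajLate, BtrajEarly]
    rcases hvisit with h | h
    · exact hvert _ _ Sum.inl_ne_inr _ (by omega) ((hu _ (by omega)).trans h.symm)
    · exact hvert _ _ Sum.inl_ne_inr _ (by omega) ((hv _ (by omega)).trans h.symm)
  · set S : Set U := {u : U | ∀ t ≤ 7 * m - 1, M' (Sum.inl u) t = xv u}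
    have hcostA (u : U) : cost (Atraj m u) (7 * m - 1) ≤
        cost (M' (Sum.inl u)) (7 * m - 1) + if u ∈ S then 2 else 0 := by
      rcases hA u with h | h
      · exact (congrArg (cost · (7 * m - 1)) h.symm).le.trans (Nat.le_add_right _ _)
      · have hu : u ∈ S := fun t _ => by rw [h]
        rw [if_pos hu]
        exact (cost_Atraj_le m u).trans (Nat.le_add_left _ _)
    have hcostB (r : Fin m) : cost (Btraj eu ev r) (7 * m - 1) ≤
        cost (M' (Sum.inr r)) (7 * m - 1) + 4 := by
      have hle := cost_Btraj_le eu ev r (7 * m - 1)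
      have hlate := two_le_cost_BtrajLate ev r
      have hearly := two_le_cost_BtrajEarly eu r
      rcases hB r with h | h | h <;> rw [h] <;> omega
    have hsumA := Finset.sum_le_sum fun u (_ : u ∈ Finset.univ) => hcostA u
    have hsumB := Finset.sum_le_sum fun r (_ : r ∈ Finset.univ) => hcostB r
    have hcard : ∑ u, (if u ∈ S then 2 else 0) = 2 * S.ncard := by
      rw [← Finset.sum_filter, Finset.sum_const, smul_eq_mul, mul_comm,
        Set.ncard_eq_toFinset_card', Set.toFinset]
      congr 2
      ext u
      simp
    simp only [Finset.sum_add_distrib, hcard, Finset.sum_const, Finset.card_univ,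
      Fintype.card_fin, smul_eq_mul] at hsumA hsumB
    simp only [scheduleCost, Fintype.sum_sum_type, Msched, Sum.elim_inl, Sum.elim_inr] at hcost
    omega
end

section
/- (Combinatorial core of the NP-hardness theorem.) In the independent-set reduction with m ≥ 1 edges and any K ∈ ℕ, the graph H has an independent set of size at least K if and only if there exists a schedule M', obtained from the constructed input schedule M by applying to each agent a sequence of collapses, such that M' is feasible and cost(M') ≤ cost(M) − 4m − 2K. -/
section Reduction

variable {U : Type*} {m : ℕ}

/-- The trajectory that waits at `a_r` until time `s`, visits `x_w` at time `s + 1`, and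
waits at `b_r` afterwards. -/
def directTraj (r : Fin m) (w : U) (s : ℕ) : ℕ → RV U m :=
  fun t => if t ≤ s then av r else if t = s + 1 then xv w else bv r

/-- Collapsing an interval on which the trajectory is constant changes nothing. -/
theorem collapse_eq_self {V : Type*} {π : ℕ → V} {a b : ℕ}
    (h : ∀ t, a ≤ t → t ≤ b → π t = π a) : collapse π a b = π := by
  funext t
  unfold collapse
  split_ifs with ht
  · exact (h t ht.1 ht.2).symm
  · rfl

theorem directTraj_collapseStep {T : ℕ} {r : Fin m} {w : U} {s : ℕ} {π : ℕ → RV U m}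
    (h : CollapseStep T (directTraj r w s) π) : π = directTraj r w s := by
  obtain ⟨a, b, hab, -, heq, rfl⟩ := h
  apply collapse_eq_self
  intro t hat htb
  have key : b ≤ s ∨ s + 2 ≤ a := by
    unfold directTraj at heq
    split_ifs at heq <;> first | omega | simp [xv, av, bv] at heq
  unfold directTraj
  split_ifs <;> first | omega | rfl

theorem Btraj_eq_cases {eu ev : Fin m → U} {r : Fin m} (huv : eu r ≠ ev r) {a b : ℕ}
    (hab : a < b) (heq : Btraj eu ev r a = Btraj eu ev r b) :
    b ≤ 7 * (r : ℕ) ∨ 7 * (r : ℕ) + 6 ≤ a ∨ (a ≤ 7 * (r : ℕ) ∧ b = 7 * (r : ℕ) + 4) ∨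
      (a = 7 * (r : ℕ) + 2 ∧ 7 * (r : ℕ) + 6 ≤ b) := by
  unfold Btraj at heq
  split_ifs at heq <;> first | omega | simp [xv, av, bv, cv, huv] at heq

theorem Btraj_collapse_left (eu ev : Fin m → U) (r : Fin m) {a : ℕ}
    (ha : a ≤ 7 * (r : ℕ)) :
    collapse (Btraj eu ev r) a (7 * (r : ℕ) + 4) =
      directTraj r (ev r) (7 * (r : ℕ) + 4) := by
  funext t
  simp only [collapse, Btraj, directTraj]
  split_ifs <;> first | omega | rfl

theorem Btraj_collapse_right (eu ev : Fin m → U) (r : Fin m) {b : ℕ}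
    (hb : 7 * (r : ℕ) + 6 ≤ b) :
    collapse (Btraj eu ev r) (7 * (r : ℕ) + 2) b = directTraj r (eu r) (7 * (r : ℕ)) := by
  funext t
  simp only [collapse, Btraj, directTraj]
  split_ifs <;> first | omega | rfl

theorem Btraj_collapseStep {T : ℕ} {eu ev : Fin m → U} {r : Fin m} (huv : eu r ≠ ev r)
    {π : ℕ → RV U m} (h : CollapseStep T (Btraj eu ev r) π) :
    π = Btraj eu ev r ∨ π = directTraj r (eu r) (7 * (r : ℕ)) ∨
      π = directTraj r (ev r) (7 * (r : ℕ) + 4) := by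
  obtain ⟨a, b, hab, -, heq, rfl⟩ := h
  rcases Btraj_eq_cases huv hab heq with h | h | ⟨h, rfl⟩ | ⟨rfl, h⟩
  · left
    apply collapse_eq_self
    intro t hat htb
    unfold Btraj
    rw [if_pos (by omega), if_pos (by omega)]
  · left
    apply collapse_eq_self
    intro t hat htb
    unfold Btraj
    split_ifs <;> first | omega | rfl
  · exact Or.inr (Or.inr (Btraj_collapse_left eu ev r h))
  · exact Or.inr (Or.inl (Btraj_collapse_right eu ev r h))

/-- The trajectories reachable from an edge-agent trajectory by collapses. -/
theorem Btraj_reachable {T : ℕ} {eu ev : Fin m → U} {r : Fin m} (huv : eu r ≠ ev r)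
    {π : ℕ → RV U m} (h : Relation.ReflTransGen (CollapseStep T) (Btraj eu ev r) π) :
    π = Btraj eu ev r ∨ π = directTraj r (eu r) (7 * (r : ℕ)) ∨
      π = directTraj r (ev r) (7 * (r : ℕ) + 4) := by
  induction h with
  | refl => exact Or.inl rfl
  | tail _ hstep ih =>
    rcases ih with rfl | rfl | rfl
    · exact Btraj_collapseStep huv hstep
    · exact Or.inr (Or.inl (directTraj_collapseStep hstep))
    · exact Or.inr (Or.inr (directTraj_collapseStep hstep))

theorem Atraj_collapse (u : U) :
    collapse (Atraj m u) 0 (7 * m - 1) = fun _ => xv u := by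
  funext t
  simp only [collapse, Atraj]
  split_ifs <;> first | omega | rfl

/-- The trajectories reachable from a vertex-agent trajectory by collapses. -/
theorem Atraj_reachable {u : U} {π : ℕ → RV U m}
    (h : Relation.ReflTransGen (CollapseStep (7 * m - 1)) (Atraj m u) π) :
    π = Atraj m u ∨ π = fun _ => xv u := by
  induction h with
  | refl => exact Or.inl rfl
  | tail _ hstep ih =>
    obtain ⟨a, b, hab, hb, heq, rfl⟩ := hstep
    rcases ih with rfl | rfl
    · have key : (0 < a ∧ b < 7 * m - 1) ∨ (a = 0 ∧ b = 7 * m - 1) := by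
        unfold Atraj at heq
        split_ifs at heq <;> first | omega | simp [xv, pv] at heq
      rcases key with h | ⟨rfl, rfl⟩
      · left
        apply collapse_eq_self
        intro t hat htb
        unfold Atraj
        split_ifs <;> first | omega | rfl
      · exact Or.inr (Atraj_collapse u)
    · exact Or.inr (collapse_eq_self fun _ _ _ => rfl)

theorem cost_eq_card {V : Type*} {π : ℕ → V} {T : ℕ} (s : Finset ℕ)
    (h : ∀ t, (t < T ∧ π t ≠ π (t + 1)) ↔ t ∈ s) : cost π T = s.card := by
  rw [cost, ← Set.ncard_coe_finset]
  congr 1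
  ext t
  exact h t

theorem cost_const {V : Type*} (v : V) (T : ℕ) : cost (fun _ => v) T = 0 := by
  simp [cost]

theorem cost_Atraj (hm : 1 ≤ m) (u : U) : cost (Atraj m u) (7 * m - 1) = 2 := by
  rw [cost_eq_card {0, 7 * m - 2}, Finset.card_pair (by omega)]
  intro t
  have hxp : (xv u : RV U m) ≠ pv u := by simp [xv, pv]
  simp only [Atraj, Nat.add_eq_zero_iff, one_ne_zero, and_false, if_false,
    Finset.mem_insert, Finset.mem_singleton]
  split_ifs <;>
    simp only [ne_eq, hxp, hxp.symm, not_true_eq_false, not_false_eq_true, and_true,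
      and_false, false_iff] <;>
    omega

theorem cost_directTraj {T s : ℕ} (hs : s + 2 ≤ T) (r : Fin m) (w : U) :
    cost (directTraj r w s) T = 2 := by
  rw [cost_eq_card {s, s + 1}, Finset.card_pair (by omega)]
  intro t
  simp only [directTraj, Finset.mem_insert, Finset.mem_singleton]
  split_ifs <;> simp [xv, av, bv] <;> omega

theorem cost_Btraj (eu ev : Fin m → U) (r : Fin m) :
    cost (Btraj eu ev r) (7 * m - 1) = 6 := by
  have hr := r.isLt
  rw [cost_eq_card (Finset.Ico (7 * (r : ℕ)) (7 * (r : ℕ) + 6)), Nat.card_Ico]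
  · omega
  intro t
  simp only [Btraj, Finset.mem_Ico]
  split_ifs <;> simp [xv, av, bv, cv] <;> omega

theorem scheduleCost_sum [Fintype U] (M : (U ⊕ Fin m) → ℕ → RV U m) (T : ℕ) :
    scheduleCost M T = ∑ u, cost (M (Sum.inl u)) T + ∑ r, cost (M (Sum.inr r)) T :=
  Fintype.sum_sum_type _

theorem scheduleCost_Msched [Fintype U] (hm : 1 ≤ m) (eu ev : Fin m → U) :
    scheduleCost (Msched m eu ev) (7 * m - 1) = 2 * Fintype.card U + 6 * m := by
  simp [scheduleCost_sum, Msched, cost_Atraj hm, cost_Btraj]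
  ring

theorem gValid_Atraj (eu ev : Fin m → U) (u : U) (t : ℕ) :
    Atraj m u t = Atraj m u (t + 1) ∨ (RG m eu ev).Adj (Atraj m u t) (Atraj m u (t + 1)) := by
  have h : (RG m eu ev).Adj (xv u) (pv u) :=
    (SimpleGraph.fromRel_adj _ _ _).2 ⟨by simp [xv, pv], Or.inl (Or.inl ⟨u, rfl, rfl⟩)⟩
  unfold Atraj
  split_ifs <;> first | omega | exact Or.inl rfl | exact Or.inr h | exact Or.inr h.symm

theorem gValid_directTraj (eu ev : Fin m → U) (r : Fin m) {w : U} (hw : w = eu r ∨ w = ev r)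
    (s t : ℕ) :
    directTraj r w s t = directTraj r w s (t + 1) ∨
      (RG m eu ev).Adj (directTraj r w s t) (directTraj r w s (t + 1)) := by
  have hax : (RG m eu ev).Adj (av r) (xv w) := by
    refine (SimpleGraph.fromRel_adj _ _ _).2 ⟨by simp [xv, av], Or.inl (Or.inr ⟨r, ?_⟩)⟩
    rcases hw with rfl | rfl <;> simp
  have hxb : (RG m eu ev).Adj (xv w) (bv r) := by
    refine (SimpleGraph.fromRel_adj _ _ _).2 ⟨by simp [xv, bv], Or.inl (Or.inr ⟨r, ?_⟩)⟩
    rcases hw with rfl | rfl <;> simp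
  unfold directTraj
  split_ifs <;> first | omega | exact Or.inl rfl | exact Or.inr hax | exact Or.inr hxb

/-- If every move of an agent starts or ends at a vertex that no other agent visits, then
there is no edge collision. -/
theorem noEdgeCollision_of_private {V ι : Type*} {T : ℕ} {M : ι → ℕ → V} (P : ι → V → Prop)
    (hP : ∀ i j, i ≠ j → ∀ t, ¬ P j (M i t))
    (hmove : ∀ j t, M j t = M j (t + 1) ∨ P j (M j t) ∨ P j (M j (t + 1))) :
    NoEdgeCollision T M := by
  rintro i j hij t - ⟨h₁, h₂, h₃⟩
  rcases hmove j t with h | h | h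
  · exact h₃ (h.trans h₁.symm)
  · exact hP i j hij (t + 1) (h₂ ▸ h)
  · exact hP i j hij t (h₁ ▸ h)

section Construction

open Classical in
/-- The endpoint of edge `r` through which its agent is routed, avoiding the set `S`. -/
noncomputable def routeVertex (eu ev : Fin m → U) (S : Finset U) (r : Fin m) : U :=
  if eu r ∈ S then ev r else eu r

open Classical in
/-- The last time at which the rerouted agent of edge `r` waits at `a_r`. -/
noncomputable def routeTime (eu : Fin m → U) (S : Finset U) (r : Fin m) : ℕ :=
  if eu r ∈ S then 7 * (r : ℕ) + 4 else 7 * (r : ℕ)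

open Classical in
/-- The schedule associated with a set `S`: the vertex-agents in `S` are fully collapsed,
and every edge-agent visits only the endpoint given by `routeVertex`. -/
noncomputable def routedSched (eu ev : Fin m → U) (S : Finset U) :
    (U ⊕ Fin m) → ℕ → RV U m :=
  Sum.elim (fun u => if u ∈ S then fun _ => xv u else Atraj m u)
    (fun r => directTraj r (routeVertex eu ev S r) (routeTime eu S r))

/-- The vertices that only the given agent visits. -/
def IsPrivate : (U ⊕ Fin m) → RV U m → Prop
  | Sum.inl u, w => w = pv u
  | Sum.inr r, w => w = av r ∨ w = bv r

variable (eu ev : Fin m → U) (S : Finset U)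

theorem routeTime_bounds (r : Fin m) :
    7 * (r : ℕ) ≤ routeTime eu S r ∧ routeTime eu S r ≤ 7 * (r : ℕ) + 4 := by
  unfold routeTime
  split_ifs <;> omega

theorem routedSched_inl_cases (u : U) (t : ℕ) :
    routedSched eu ev S (Sum.inl u) t = xv u ∨ routedSched eu ev S (Sum.inl u) t = pv u := by
  simp only [routedSched, Sum.elim_inl]
  split_ifs
  · exact Or.inl rfl
  · unfold Atraj
    split_ifs <;> simp

theorem routedSched_inr_cases (r : Fin m) (t : ℕ) :
    routedSched eu ev S (Sum.inr r) t = av r ∨ routedSched eu ev S (Sum.inr r) t = bv r ∨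
      (t = routeTime eu S r + 1 ∧
        routedSched eu ev S (Sum.inr r) t = xv (routeVertex eu ev S r)) := by
  simp only [routedSched, Sum.elim_inr, directTraj]
  split_ifs <;> simp_all

theorem routedSched_reachable (i : U ⊕ Fin m) :
    Relation.ReflTransGen (CollapseStep (7 * m - 1)) (Msched m eu ev i)
      (routedSched eu ev S i) := by
  rcases i with u | r
  · simp only [Msched, routedSched, Sum.elim_inl]
    split_ifs
    · by_cases hm : 1 ≤ m
      · refine Relation.ReflTransGen.single
          ⟨0, 7 * m - 1, by omega, le_rfl, ?_, (Atraj_collapse u).symm⟩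
        simp [Atraj]
      · have h : (fun _ => xv u) = Atraj m u := by
          funext t
          unfold Atraj
          split_ifs <;> first | omega | rfl
        rw [h]
    · exact Relation.ReflTransGen.refl
  · have hr := r.isLt
    simp only [Msched, routedSched, Sum.elim_inr, routeVertex, routeTime]
    apply Relation.ReflTransGen.single
    split_ifs
    · refine ⟨7 * r, 7 * r + 4, by omega, by omega, ?_,
        (Btraj_collapse_left eu ev r le_rfl).symm⟩
      simp [Btraj]
    · refine ⟨7 * r + 2, 7 * r + 6, by omega, by omega, ?_,
        (Btraj_collapse_right eu ev r le_rfl).symm⟩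
      simp [Btraj]

variable {eu ev S}

theorem routeVertex_notMem (hS : ∀ r : Fin m, ¬(eu r ∈ S ∧ ev r ∈ S)) (r : Fin m) :
    routeVertex eu ev S r ∉ S := by
  unfold routeVertex
  split_ifs with h
  · exact fun h' => hS r ⟨h, h'⟩
  · exact h

/-- A vertex-agent and an edge-agent of the routed schedule never meet. -/
theorem routedSched_inl_ne_inr (hS : ∀ r : Fin m, ¬(eu r ∈ S ∧ ev r ∈ S)) (u : U)
    (r : Fin m) (t : ℕ) :
    routedSched eu ev S (Sum.inl u) t ≠ routedSched eu ev S (Sum.inr r) t := by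
  intro h
  rcases routedSched_inr_cases eu ev S r t with h' | h' | ⟨ht, h'⟩
  · rcases routedSched_inl_cases eu ev S u t with h'' | h'' <;>
      simp [h', h'', xv, pv, av] at h
  · rcases routedSched_inl_cases eu ev S u t with h'' | h'' <;>
      simp [h', h'', xv, pv, bv] at h
  · have hb := routeTime_bounds eu S r
    have hr := r.isLt
    have hu : u ∉ S := by
      rcases routedSched_inl_cases eu ev S u t with h'' | h''
      · have : u = routeVertex eu ev S r := by simpa [h', h'', xv] using h
        exact this ▸ routeVertex_notMem hS r
      · simp [h', h'', xv, pv] at h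
    have hp : routedSched eu ev S (Sum.inl u) t = pv u := by
      simp only [routedSched, Sum.elim_inl, if_neg hu, Atraj]
      rw [if_neg (by omega), if_pos (by omega)]
    simp [hp, h', xv, pv] at h

theorem routedSched_noVertexCollision (hS : ∀ r : Fin m, ¬(eu r ∈ S ∧ ev r ∈ S)) (T : ℕ) :
    NoVertexCollision T (routedSched eu ev S) := by
  rintro (u | r) (v | s) hij t - h
  · rcases routedSched_inl_cases eu ev S u t with h₁ | h₁ <;>
      rcases routedSched_inl_cases eu ev S v t with h₂ | h₂ <;>
      simp_all [xv, pv]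
  · exact routedSched_inl_ne_inr hS u s t h
  · exact routedSched_inl_ne_inr hS v r t h.symm
  · have hrs : r ≠ s := fun h => hij (congrArg _ h)
    have hrs' : (r : ℕ) ≠ s := fun h => hrs (Fin.ext h)
    have hr := routeTime_bounds eu S r
    have hs := routeTime_bounds eu S s
    rcases routedSched_inr_cases eu ev S r t with h₁ | h₁ | ⟨ht₁, h₁⟩ <;>
      rcases routedSched_inr_cases eu ev S s t with h₂ | h₂ | ⟨ht₂, h₂⟩ <;>
      rw [h₁, h₂] at h <;>
      first
        | omega
        | simp [xv, av, bv, hrs] at h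

theorem routedSched_gValid (T : ℕ) : GValid (RG m eu ev) T (routedSched eu ev S) := by
  rintro (u | r) t -
  · simp only [routedSched, Sum.elim_inl]
    split_ifs
    · exact Or.inl rfl
    · exact gValid_Atraj eu ev u t
  · refine gValid_directTraj eu ev r ?_ _ t
    unfold routeVertex
    split_ifs <;> simp

theorem routedSched_noEdgeCollision (T : ℕ) :
    NoEdgeCollision T (routedSched eu ev S) := by
  apply noEdgeCollision_of_private IsPrivate
  · rintro (u | r) j hij t hj
    · rcases j with v | s
      · have huv : u ≠ v := fun h => hij (congrArg _ h)
        rcases routedSched_inl_cases eu ev S u t with h | h <;>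
          simp [IsPrivate, h, xv, pv, huv] at hj
      · rcases routedSched_inl_cases eu ev S u t with h | h <;>
          simp [IsPrivate, h, xv, pv, av, bv] at hj
    · rcases j with v | s
      · rcases routedSched_inr_cases eu ev S r t with h | h | ⟨-, h⟩ <;>
          simp [IsPrivate, h, xv, pv, av, bv] at hj
      · have hrs : r ≠ s := fun h => hij (congrArg _ h)
        rcases routedSched_inr_cases eu ev S r t with h | h | ⟨-, h⟩ <;>
          simp [IsPrivate, h, xv, av, bv, hrs] at hj
  · rintro (u | r) t
    · rcases routedSched_inl_cases eu ev S u t with h | h <;>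
        rcases routedSched_inl_cases eu ev S u (t + 1) with h' | h' <;>
        simp [IsPrivate, h, h']
    · rcases routedSched_inr_cases eu ev S r t with h | h | ⟨ht, h⟩
      · exact Or.inr (Or.inl (Or.inl h))
      · exact Or.inr (Or.inl (Or.inr h))
      · rcases routedSched_inr_cases eu ev S r (t + 1) with h' | h' | ⟨ht', -⟩
        · exact Or.inr (Or.inr (Or.inl h'))
        · exact Or.inr (Or.inr (Or.inr h'))
        · omega

theorem scheduleCost_routedSched [Fintype U] (hm : 1 ≤ m) :
    scheduleCost (routedSched eu ev S) (7 * m - 1) + 2 * S.card =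
      2 * Fintype.card U + 2 * m := by
  classical
  have hA : ∀ u, cost (routedSched eu ev S (Sum.inl u)) (7 * m - 1) +
      (if u ∈ S then 2 else 0) = 2 := by
    intro u
    simp only [routedSched, Sum.elim_inl]
    split_ifs
    · rw [cost_const]
    · rw [cost_Atraj hm]
  have hB : ∀ r, cost (routedSched eu ev S (Sum.inr r)) (7 * m - 1) = 2 := by
    intro r
    have hr := r.isLt
    have hb := routeTime_bounds eu S r
    exact cost_directTraj (by omega) r _
  have hsum := Finset.sum_congr (rfl : (Finset.univ : Finset U) = _) fun u _ => hA u
  rw [Finset.sum_add_distrib] at hsum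
  simp only [Finset.sum_ite_mem, Finset.univ_inter, Finset.sum_const, Finset.card_univ,
    smul_eq_mul] at hsum
  simp only [scheduleCost_sum, hB, Finset.sum_const, Finset.card_univ, Fintype.card_fin,
    smul_eq_mul]
  omega

end Construction

/-- Every edge-agent trajectory reachable by collapses costs at least `2` and visits one of
the endpoints of its edge. -/
theorem Btraj_reachable_cost_and_visit {eu ev : Fin m → U} {r : Fin m} (huv : eu r ≠ ev r)
    {π : ℕ → RV U m}
    (h : Relation.ReflTransGen (CollapseStep (7 * m - 1)) (Btraj eu ev r) π) :
    2 ≤ cost π (7 * m - 1) ∧ ∃ t ≤ 7 * m - 1, π t = xv (eu r) ∨ π t = xv (ev r) := by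
  have hr := r.isLt
  rcases Btraj_reachable huv h with rfl | rfl | rfl
  · refine ⟨by rw [cost_Btraj]; omega, 7 * r + 1, by omega, Or.inl ?_⟩
    simp [Btraj]
  · refine ⟨by rw [cost_directTraj (by omega)], 7 * r + 1, by omega, Or.inl ?_⟩
    simp [directTraj]
  · refine ⟨by rw [cost_directTraj (by omega)], 7 * r + 5, by omega, Or.inr ?_⟩
    simp [directTraj]

theorem exists_indepSet_of_schedule [Fintype U] (hm : 1 ≤ m) {eu ev : Fin m → U}
    (huv : ∀ r, eu r ≠ ev r) {M' : (U ⊕ Fin m) → ℕ → RV U m}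
    (hM : ∀ i, Relation.ReflTransGen (CollapseStep (7 * m - 1)) (Msched m eu ev i) (M' i))
    (hcol : NoVertexCollision (7 * m - 1) M') :
    ∃ S : Finset U, (∀ r : Fin m, ¬(eu r ∈ S ∧ ev r ∈ S)) ∧
      2 * Fintype.card U + 2 * m ≤ scheduleCost M' (7 * m - 1) + 2 * S.card := by
  classical
  let S : Finset U := {u | M' (Sum.inl u) = fun _ => xv u}
  have hmem : ∀ u, u ∈ S ↔ M' (Sum.inl u) = fun _ => xv u := fun u => by simp [S]
  have hB := fun r => Btraj_reachable_cost_and_visit (huv r) (hM (Sum.inr r))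
  refine ⟨S, fun r ⟨h₁, h₂⟩ => ?_, ?_⟩
  · obtain ⟨-, t, ht, h | h⟩ := hB r
    · exact hcol (Sum.inl (eu r)) (Sum.inr r) (by simp) t ht
        (by rw [(hmem _).1 h₁, h])
    · exact hcol (Sum.inl (ev r)) (Sum.inr r) (by simp) t ht
        (by rw [(hmem _).1 h₂, h])
  · have hA : ∀ u, 2 ≤ cost (M' (Sum.inl u)) (7 * m - 1) + (if u ∈ S then 2 else 0) := by
      intro u
      split_ifs with hu
      · omega
      · rcases Atraj_reachable (hM (Sum.inl u)) with h | h
        · rw [h, cost_Atraj hm]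
        · exact absurd ((hmem u).2 h) hu
    have hsumA := Finset.sum_le_sum fun u (_ : u ∈ Finset.univ) => hA u
    have hsumB := Finset.sum_le_sum fun r (_ : r ∈ Finset.univ) => (hB r).1
    rw [Finset.sum_add_distrib] at hsumA
    simp only [Finset.sum_ite_mem, Finset.univ_inter, Finset.sum_const, Finset.card_univ,
      smul_eq_mul, Fintype.card_fin] at hsumA hsumB
    rw [scheduleCost_sum]
    omega

end Reduction

/-- combinatorial core of the NP-hardness theorem: `H` has an
independent set of size at least `K` iff some schedule `M'` obtained from the
constructed input schedule by per-agent sequences of collapses is feasible and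
satisfies `cost(M') ≤ cost(M) − 4m − 2K`. -/
theorem stmt_15 {U : Type*} [Fintype U] (m : ℕ) (hm : 1 ≤ m) (eu ev : Fin m → U)
    (huv : ∀ r, eu r ≠ ev r)
    (hinj : ∀ r s : Fin m,
      ((eu r = eu s ∧ ev r = ev s) ∨ (eu r = ev s ∧ ev r = eu s)) → r = s)
    (K : ℕ) :
    (∃ S : Finset U, K ≤ S.card ∧ ∀ r : Fin m, ¬(eu r ∈ S ∧ ev r ∈ S)) ↔
    (∃ M' : (U ⊕ Fin m) → ℕ → RV U m,
      (∀ i, Relation.ReflTransGen (CollapseStep (7 * m - 1))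
          (Msched m eu ev i) (M' i)) ∧
      Feasible (RG m eu ev) (7 * m - 1) M' ∧
      scheduleCost M' (7 * m - 1) + (4 * m + 2 * K)
        ≤ scheduleCost (Msched m eu ev) (7 * m - 1)) := by
  rw [scheduleCost_Msched hm]
  constructor
  · rintro ⟨S, hK, hS⟩
    have hcost := scheduleCost_routedSched (eu := eu) (ev := ev) (S := S) hm
    exact ⟨routedSched eu ev S, routedSched_reachable eu ev S,
      ⟨routedSched_gValid _, routedSched_noVertexCollision hS _,
        routedSched_noEdgeCollision _⟩, by omega⟩
  · rintro ⟨M', hM, ⟨-, hcol, -⟩, hcost⟩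
    obtain ⟨S, hS, hle⟩ := exists_indepSet_of_schedule hm huv hM hcol
    exact ⟨S, by omega, hS⟩
end
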